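/- arXiv:1704.00122 — 5 statements merged into one kernel-verified Lean document; each statement's English description precedes it below -/
import Mathlib

section
/- Let A and B be n×n complex positive definite matrices, set C = A^{-1}(A#B), and suppose the geometric mean map G(A,B) = A#B has (real) Fréchet derivative D at (A,B). Then for all Hermitian matrices X, Y, the matrix D(X,Y) satisfies the Sylvester equation C*·D(X,Y) + D(X,Y)·C = Y + C* X C. -/
open Matrix MeasureTheory Real
open scoped Matrix.Norms.L2Operator ComplexOrder

-- the positive semidefinite square root of a positive semidefinite matrix (as in the older Mathlib)
noncomputable def Matrix.PosSemidef.sqrt {n 𝕜 : Type*} [Fintype n] [RCLike 𝕜] [DecidableEq n]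
    {A : Matrix n n 𝕜} (hA : A.PosSemidef) : Matrix n n 𝕜 :=
  hA.1.eigenvectorUnitary.1 * diagonal ((↑) ∘ Real.sqrt ∘ hA.1.eigenvalues) *
  (star hA.1.eigenvectorUnitary : Matrix n n 𝕜)

-- `psqrt M` is the unique positive semidefinite square root of a positive semidefinite matrix
open Classical in
noncomputable def psqrt {n : ℕ} (M : Matrix (Fin n) (Fin n) ℂ) : Matrix (Fin n) (Fin n) ℂ :=
  if h : M.PosSemidef then h.sqrt else 0

-- the geometric mean  A#B = A^{1/2} (A^{-1/2} B A^{-1/2})^{1/2} A^{1/2}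
noncomputable def gm {n : ℕ} (A B : Matrix (Fin n) (Fin n) ℂ) : Matrix (Fin n) (Fin n) ℂ :=
  psqrt A * psqrt ((psqrt A)⁻¹ * B * (psqrt A)⁻¹) * psqrt A

-- entrywise complex conjugate
def mconj {n : ℕ} (M : Matrix (Fin n) (Fin n) ℂ) : Matrix (Fin n) (Fin n) ℂ := Mᴴᵀ

-- smallest eigenvalue of a Hermitian matrix
noncomputable def lmin {n : ℕ} {C : Matrix (Fin n) (Fin n) ℂ} (hC : C.IsHermitian) : ℝ :=
  ⨅ i, hC.eigenvalues i

theorem psqrt_herm {n : ℕ} (M : Matrix (Fin n) (Fin n) ℂ) : (psqrt M).IsHermitian := by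
  unfold psqrt
  split_ifs with h
  · unfold Matrix.PosSemidef.sqrt
    have hd : (diagonal ((↑) ∘ Real.sqrt ∘ h.1.eigenvalues) : Matrix (Fin n) (Fin n) ℂ).IsHermitian := by
      rw [Matrix.IsHermitian, diagonal_conjTranspose]
      congr 1
      ext i
      simp
    exact isHermitian_mul_mul_conjTranspose _ hd
  · exact isHermitian_zero

theorem psqrt_sq {n : ℕ} {M : Matrix (Fin n) (Fin n) ℂ} (h : M.PosSemidef) :
    psqrt M * psqrt M = M := by
  unfold psqrt
  rw [dif_pos h]
  unfold Matrix.PosSemidef.sqrt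
  have hU : (star h.1.eigenvectorUnitary : Matrix (Fin n) (Fin n) ℂ) *
      h.1.eigenvectorUnitary.1 = 1 := Unitary.coe_star_mul_self _
  have hd : (diagonal ((↑) ∘ Real.sqrt ∘ h.1.eigenvalues) : Matrix (Fin n) (Fin n) ℂ) *
      diagonal ((↑) ∘ Real.sqrt ∘ h.1.eigenvalues) = diagonal ((↑) ∘ h.1.eigenvalues) := by
    rw [diagonal_mul_diagonal]
    congr 1
    ext i
    simp only [Function.comp]
    rw [← Complex.ofReal_mul, Real.mul_self_sqrt (h.eigenvalues_nonneg i)]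
  have hs := h.1.spectral_theorem
  rw [Unitary.conjStarAlgAut_apply] at hs
  conv_rhs => rw [hs]
  generalize (star h.1.eigenvectorUnitary : Matrix (Fin n) (Fin n) ℂ) = V at *
  generalize (h.1.eigenvectorUnitary.1 : Matrix (Fin n) (Fin n) ℂ) = U at *
  calc _ = U * diagonal ((↑) ∘ Real.sqrt ∘ h.1.eigenvalues) * (V * U) *
        diagonal ((↑) ∘ Real.sqrt ∘ h.1.eigenvalues) * V := by
        simp only [mul_assoc]; rfl
    _ = U * (diagonal ((↑) ∘ Real.sqrt ∘ h.1.eigenvalues) *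
        diagonal ((↑) ∘ Real.sqrt ∘ h.1.eigenvalues)) * V := by rw [hU]; simp only [mul_assoc, one_mul]
    _ = _ := by rw [hd]; rfl

theorem psqrt_isUnit {n : ℕ} {M : Matrix (Fin n) (Fin n) ℂ} (h : M.PosDef) :
    IsUnit (psqrt M) := by
  have h1 := h.isUnit
  rw [← psqrt_sq h.posSemidef] at h1
  rw [Matrix.isUnit_iff_isUnit_det] at h1 ⊢
  rw [det_mul] at h1
  exact isUnit_of_mul_isUnit_left h1

theorem gm_riccati {n : ℕ} {A B : Matrix (Fin n) (Fin n) ℂ} (hA : A.PosDef) (hB : B.PosDef) :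
    gm A B * A⁻¹ * gm A B = B := by
  have hS := psqrt_isUnit hA
  have hq := psqrt_sq hA.posSemidef
  have hSh := psqrt_herm A
  rw [Matrix.isUnit_iff_isUnit_det] at hS
  unfold gm
  have hM : ((psqrt A)⁻¹ * B * (psqrt A)⁻¹).PosSemidef := by
    have := hB.posSemidef.mul_mul_conjTranspose_same (psqrt A)⁻¹
    rwa [hSh.inv.eq] at this
  have hT := psqrt_sq hM
  have hi : A⁻¹ = (psqrt A)⁻¹ * (psqrt A)⁻¹ := by
    rw [← Matrix.mul_inv_rev, hq]
  rw [hi]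
  generalize psqrt ((psqrt A)⁻¹ * B * (psqrt A)⁻¹) = T at *
  generalize psqrt A = S at *
  have h1 := Matrix.mul_nonsing_inv S hS
  have h2 := Matrix.nonsing_inv_mul S hS
  calc _ = S * T * (S * S⁻¹) * (S⁻¹ * S) * T * S := by simp only [mul_assoc]
    _ = S * (T * T) * S := by rw [h1, h2]; simp only [mul_assoc, one_mul]
    _ = (S * S⁻¹) * B * (S⁻¹ * S) := by rw [hT]; simp only [mul_assoc]
    _ = B := by rw [h1, h2, one_mul, mul_one]

open scoped MatrixOrder in
theorem one_add_posDef {n : ℕ} {H : Matrix (Fin n) (Fin n) ℂ} (hH : H.IsHermitian)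
    (h1 : ‖H‖ < 1) : (1 + H).PosDef := by
  have h := IsSelfAdjoint.neg_algebraMap_norm_le_self (a := H) hH
  rw [Matrix.le_iff, sub_neg_eq_add] at h
  have h2 : ((1 - ‖H‖) • (1 : Matrix (Fin n) (Fin n) ℂ)).PosDef :=
    Matrix.PosDef.smul Matrix.PosDef.one (sub_pos.2 h1)
  have h3 := h2.add_posSemidef h
  convert h3 using 1
  rw [Algebra.algebraMap_eq_smul_one, sub_smul, one_smul]
  abel

theorem eventually_posDef {n : ℕ} {A X : Matrix (Fin n) (Fin n) ℂ} (hA : A.PosDef)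
    (hX : X.IsHermitian) : ∀ᶠ t : ℝ in nhds 0, (A + t • X).PosDef := by
  have hS := psqrt_isUnit hA
  have hq := psqrt_sq hA.posSemidef
  have hSh := psqrt_herm A
  have hSd := hS
  rw [Matrix.isUnit_iff_isUnit_det] at hSd
  generalize psqrt A = S at *
  have h1 := Matrix.mul_nonsing_inv S hSd
  have h2 := Matrix.nonsing_inv_mul S hSd
  have hH : (S⁻¹ * X * S⁻¹).IsHermitian := by
    have := isHermitian_mul_mul_conjTranspose S⁻¹ hX
    rwa [hSh.inv.eq] at this
  have hc : Filter.Tendsto (fun t : ℝ => ‖t • (S⁻¹ * X * S⁻¹)‖) (nhds 0) (nhds 0) := by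
    have : Continuous (fun t : ℝ => ‖t • (S⁻¹ * X * S⁻¹)‖) := by fun_prop
    simpa using this.tendsto 0
  filter_upwards [hc.eventually (gt_mem_nhds one_pos)] with t ht
  have h3 := one_add_posDef (H := t • (S⁻¹ * X * S⁻¹))
    (by rw [Matrix.IsHermitian, conjTranspose_smul, hH.eq]; simp) ht
  have h4 := h3.conjTranspose_mul_mul_same (mulVec_injective_of_isUnit hS)
  rw [hSh.eq] at h4
  convert h4 using 1
  have : S * (S⁻¹ * X * S⁻¹) * S = X := by
    calc _ = (S * S⁻¹) * X * (S⁻¹ * S) := by simp only [mul_assoc]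
      _ = X := by rw [h1, h2, one_mul, mul_one]
  rw [mul_add, add_mul, mul_one, hq, mul_smul_comm, smul_mul_assoc, this]

/-- the derivative of the geometric mean map satisfies the Sylvester equation
`C* D(X,Y) + D(X,Y) C = Y + C* X C` for Hermitian `X, Y`, where `C = A⁻¹ (A#B)`. -/
theorem stmt1 {n : ℕ} (hn : 0 < n) (A B : Matrix (Fin n) (Fin n) ℂ)
    (hA : A.PosDef) (hB : B.PosDef)
    (C : Matrix (Fin n) (Fin n) ℂ) (hC : C = A⁻¹ * gm A B)
    (D : Matrix (Fin n) (Fin n) ℂ × Matrix (Fin n) (Fin n) ℂ →L[ℝ] Matrix (Fin n) (Fin n) ℂ)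
    (hD : HasFDerivWithinAt (fun p : Matrix (Fin n) (Fin n) ℂ × Matrix (Fin n) (Fin n) ℂ =>
        gm p.1 p.2) D
      {p : Matrix (Fin n) (Fin n) ℂ × Matrix (Fin n) (Fin n) ℂ |
        p.1.IsHermitian ∧ p.2.IsHermitian} (A, B)) :
    ∀ X Y : Matrix (Fin n) (Fin n) ℂ, X.IsHermitian → Y.IsHermitian →
      Cᴴ * D (X, Y) + D (X, Y) * C = Y + Cᴴ * X * C := by
  intro X Y hX hY
  have hline : ∀ Z W : Matrix (Fin n) (Fin n) ℂ,
      HasDerivAt (fun t : ℝ => Z + t • W) W 0 := fun Z W => by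
    simpa using ((hasDerivAt_id (0 : ℝ)).smul_const W).const_add Z
  have hp : HasDerivAt (fun t : ℝ => (A + t • X, B + t • Y)) (X, Y) 0 :=
    (hline A X).prodMk (hline B Y)
  have hg := hD.comp_hasDerivAt_of_eq (0 : ℝ) hp
    (Filter.Eventually.of_forall fun t => by
      constructor
      · exact hA.1.add (by simp [Matrix.IsHermitian, conjTranspose_smul, hX.eq])
      · exact hB.1.add (by simp [Matrix.IsHermitian, conjTranspose_smul, hY.eq])) (by simp)
  have hinv : HasDerivAt (fun t : ℝ => (A + t • X)⁻¹) (-(A⁻¹ * X * A⁻¹)) 0 := by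
    obtain ⟨u, hu⟩ := hA.isUnit
    have h1 := (hasFDerivAt_ringInverse (𝕜 := ℝ) u).comp_hasDerivAt_of_eq (0 : ℝ) (hline A X)
      (by simp [hu])
    have hui : (↑u⁻¹ : Matrix (Fin n) (Fin n) ℂ) = A⁻¹ := by
      rw [← hu, Matrix.coe_units_inv]
    simp only [nonsing_inv_eq_ringInverse] at hui ⊢
    simpa [hui, Function.comp_def] using h1
  have hprod := (hg.mul hinv).mul hg
  have hB' := (hline B Y).congr_of_eventuallyEq (f₁ := fun t : ℝ =>
      gm (A + t • X) (B + t • Y) * (A + t • X)⁻¹ * gm (A + t • X) (B + t • Y)) (by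
    filter_upwards [eventually_posDef hA hX, eventually_posDef hB hY] with t h1 h2
    exact gm_riccati h1 h2)
  have key := hprod.unique hB'
  simp only [Function.comp, Pi.mul_apply, zero_smul, add_zero] at key
  generalize D (X, Y) = E at *
  have hGh : (gm A B).IsHermitian := by
    have := isHermitian_mul_mul_conjTranspose (psqrt A)
      (psqrt_herm ((psqrt A)⁻¹ * B * (psqrt A)⁻¹))
    rwa [(psqrt_herm A).eq] at this
  have hCh : Cᴴ = gm A B * A⁻¹ := by
    rw [hC, conjTranspose_mul, hGh.eq, hA.1.inv.eq]
  rw [hCh, hC, ← key]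
  noncomm_ring
end

section
/- Under the stated hypotheses, set M = (W*A − P₁Y₂)·P₂^{-1}. Then X·P₁ + P₁·X = M − M*, and consequently ‖X‖ ≤ (‖P₁^{-1}‖/2)·‖M − M*‖. -/
open Matrix MeasureTheory Real
open scoped Matrix.Norms.L2Operator ComplexOrder

open scoped InnerProductSpace in
theorem aux_norm {n : ℕ} (hn : 0 < n) (P Q X : Matrix (Fin n) (Fin n) ℂ)
    (hQ : Q.PosDef) (hQ2 : Q * Q = P) (hX : Xᴴ = -X) :
    ‖X‖ ≤ ‖P⁻¹‖ / 2 * ‖X * P + P * X‖ := by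
  haveI : Nonempty (Fin n) := ⟨⟨0, hn⟩⟩
  have hnorm : IsStarNormal X := by
    constructor
    rw [star_eq_conjTranspose, hX]
    exact (Commute.refl X).neg_left
  obtain ⟨l, hl, hlr⟩ := spectrum.exists_nnnorm_eq_spectralRadius X
  have hlX : ‖l‖ = ‖X‖ := by
    rw [IsStarNormal.spectralRadius_eq_nnnorm X] at hlr
    have h2 : ‖l‖₊ = ‖X‖₊ := by exact_mod_cast hlr
    exact congrArg NNReal.toReal h2
  rw [spectrum.mem_iff, Matrix.isUnit_iff_isUnit_det, isUnit_iff_ne_zero, not_not,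
    ← Matrix.exists_mulVec_eq_zero_iff] at hl
  obtain ⟨v, hv0, hv⟩ := hl
  have hXv : X *ᵥ v = l • v := by
    rw [Matrix.sub_mulVec, sub_eq_zero, Algebra.algebraMap_eq_smul_one, Matrix.smul_mulVec,
      Matrix.one_mulVec] at hv
    exact hv.symm
  have hvX : star v ᵥ* X = (-star l) • star v := by
    have := congrArg star hXv
    rw [Matrix.star_mulVec, hX, Matrix.vecMul_neg, star_smul] at this
    rw [neg_smul, ← this, neg_neg]
  have hvv : star v ⬝ᵥ v ≠ 0 := by
    rwa [Ne, dotProduct_star_self_eq_zero]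
  have hll : -star l = l := by
    have h1 : star v ⬝ᵥ (X *ᵥ v) = l * (star v ⬝ᵥ v) := by
      rw [hXv, dotProduct_smul, smul_eq_mul]
    rw [Matrix.dotProduct_mulVec, hvX, smul_dotProduct, smul_eq_mul] at h1
    exact mul_right_cancel₀ hvv h1
  have hQH : Qᴴ = Q := hQ.1
  set w := Q *ᵥ v with hw
  have hvP : star v ⬝ᵥ (P *ᵥ v) = star w ⬝ᵥ w := by
    rw [hw, Matrix.star_mulVec, hQH, ← Matrix.dotProduct_mulVec, Matrix.mulVec_mulVec, hQ2]
  have hD : star v ⬝ᵥ ((X * P + P * X) *ᵥ v) = 2 * l * (star w ⬝ᵥ w) := by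
    rw [Matrix.add_mulVec, dotProduct_add, ← Matrix.mulVec_mulVec, ← Matrix.mulVec_mulVec, hXv,
      Matrix.dotProduct_mulVec, hvX, hll, Matrix.mulVec_smul, dotProduct_smul, smul_dotProduct,
      hvP, smul_eq_mul]
    ring
  have hself : ∀ u : Fin n → ℂ, star u ⬝ᵥ u = ((‖WithLp.toLp 2 u‖ ^ 2 : ℝ) : ℂ) := by
    intro u
    have := inner_self_eq_norm_sq_to_K (𝕜 := ℂ) (WithLp.toLp 2 u)
    rw [EuclideanSpace.inner_toLp_toLp, dotProduct_comm] at this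
    rw [this]; push_cast; rfl
  have hcs : ‖star v ⬝ᵥ ((X * P + P * X) *ᵥ v)‖ ≤ ‖X * P + P * X‖ * ‖WithLp.toLp 2 v‖ ^ 2 := by
    have h1 := norm_inner_le_norm (𝕜 := ℂ) (WithLp.toLp 2 v)
      (WithLp.toLp 2 ((X * P + P * X) *ᵥ v))
    rw [EuclideanSpace.inner_toLp_toLp, dotProduct_comm] at h1
    have h2 := Matrix.l2_opNorm_mulVec (X * P + P * X) (WithLp.toLp 2 v)
    calc _ ≤ _ := h1
      _ ≤ ‖WithLp.toLp 2 v‖ * (‖X * P + P * X‖ * ‖WithLp.toLp 2 v‖) := by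
        gcongr
        exact h2
      _ = _ := by ring
  have hQu : IsUnit Q.det := (Matrix.isUnit_iff_isUnit_det _).1 hQ.isUnit
  have hQi : ‖P⁻¹‖ = ‖Q⁻¹‖ * ‖Q⁻¹‖ := by
    rw [← Matrix.l2_opNorm_conjTranspose_mul_self, Matrix.conjTranspose_nonsing_inv, hQH,
      ← Matrix.mul_inv_rev, hQ2]
  have hvw : ‖WithLp.toLp 2 v‖ ≤ ‖Q⁻¹‖ * ‖WithLp.toLp 2 w‖ := by
    have h2 := Matrix.l2_opNorm_mulVec Q⁻¹ (WithLp.toLp 2 w)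
    have h3 : Q⁻¹ *ᵥ w = v := by
      rw [hw, Matrix.mulVec_mulVec, Matrix.nonsing_inv_mul _ hQu, Matrix.one_mulVec]
    simpa [h3] using h2
  have hv2 : ‖WithLp.toLp 2 v‖ ^ 2 ≤ ‖P⁻¹‖ * ‖WithLp.toLp 2 w‖ ^ 2 := by
    calc _ ≤ (‖Q⁻¹‖ * ‖WithLp.toLp 2 w‖) ^ 2 := by gcongr
      _ = _ := by rw [hQi]; ring
  have hvpos : 0 < ‖WithLp.toLp 2 v‖ := by
    rw [norm_pos_iff]
    simpa using hv0
  have hwpos : 0 < ‖WithLp.toLp 2 w‖ ^ 2 := by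
    have : ‖WithLp.toLp 2 w‖ ≠ 0 := by
      intro h
      rw [h] at hvw
      linarith
    positivity
  rw [hD, hself w, norm_mul, norm_mul, Complex.norm_real, Real.norm_of_nonneg hwpos.le,
    Complex.norm_two, hlX] at hcs
  have : 2 * ‖X‖ ≤ ‖X * P + P * X‖ * ‖P⁻¹‖ := by
    refine le_of_mul_le_mul_right ?_ hwpos
    calc _ ≤ _ := hcs
      _ ≤ ‖X * P + P * X‖ * (‖P⁻¹‖ * ‖WithLp.toLp 2 w‖ ^ 2) := by gcongr
      _ = _ := by ring
  linarith

/-- with `M = (W*A − P₁Y₂)P₂⁻¹` one has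
`X P₁ + P₁ X = M − M*` and `‖X‖ ≤ (‖P₁⁻¹‖/2) ‖M − M*‖`. -/
theorem stmt11 {n : ℕ} (hn : 0 < n)
    (W P₁ Q P₂ X Y₁ Y₂ A : Matrix (Fin n) (Fin n) ℂ)
    (hW : W ∈ Matrix.unitaryGroup (Fin n) ℂ)
    (hP₁ : P₁.PosDef) (hcirc : mconj P₁ * P₁ = 1)
    (hQ : Q.PosDef) (hQ2 : Q * Q = P₁)
    (hP₂ : P₂.PosDef) (hP₂r : ∀ i j, (P₂ i j).im = 0)
    (hX : Xᴴ = -X)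
    (hY₁r : ∀ i j, (Y₁ i j).im = 0) (hY₁ : Y₁ᵀ = -Y₁)
    (hY₂r : ∀ i j, (Y₂ i j).im = 0) (hY₂ : Y₂ᵀ = Y₂)
    (hA : A = W * X * P₁ * P₂ + W * Q * (Complex.I • Y₁) * Q * P₂ + W * P₁ * Y₂)
    (M : Matrix (Fin n) (Fin n) ℂ)
    (hM : M = (Wᴴ * A - P₁ * Y₂) * P₂⁻¹) :
    X * P₁ + P₁ * X = M - Mᴴ ∧ ‖X‖ ≤ ‖P₁⁻¹‖ / 2 * ‖M - Mᴴ‖ := by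
  have hWW : Wᴴ * W = 1 := (Matrix.mem_unitaryGroup_iff').1 hW
  have hP₂u : IsUnit P₂.det := (Matrix.isUnit_iff_isUnit_det _).1 hP₂.isUnit
  have hM' : M = X * P₁ + Q * (Complex.I • Y₁) * Q := by
    have h1 : Wᴴ * A - P₁ * Y₂ = (X * P₁ + Q * (Complex.I • Y₁) * Q) * P₂ := by
      rw [hA]
      have : Wᴴ * (W * X * P₁ * P₂ + W * Q * (Complex.I • Y₁) * Q * P₂ + W * P₁ * Y₂)
          = (Wᴴ * W) * (X * P₁ * P₂ + Q * (Complex.I • Y₁) * Q * P₂ + P₁ * Y₂) := by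
        noncomm_ring
      rw [this, hWW, one_mul, add_mul, add_sub_cancel_right]
    rw [hM, h1, Matrix.mul_nonsing_inv_cancel_right _ _ hP₂u]
  have hY : (Complex.I • Y₁)ᴴ = Complex.I • Y₁ := by
    ext i j
    have h1 : Y₁ j i = - Y₁ i j := by
      have := congrFun (congrFun hY₁ i) j
      simpa using this
    have h2 : star (Y₁ i j) = Y₁ i j := Complex.conj_eq_iff_im.2 (hY₁r i j)
    simp only [Matrix.conjTranspose_apply, Matrix.smul_apply, smul_eq_mul, h1, star_mul', star_neg,
      h2, Complex.star_def, Complex.conj_I]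
    simp [← Complex.star_def, h2]
  have key : X * P₁ + P₁ * X = M - Mᴴ := by
    rw [hM', Matrix.conjTranspose_add, Matrix.conjTranspose_mul, Matrix.conjTranspose_mul,
      Matrix.conjTranspose_mul, hY, hX, hP₁.1.eq, hQ.1.eq]
    noncomm_ring
  refine ⟨key, ?_⟩
  rw [← key]
  exact aux_norm hn P₁ Q X hQ hQ2 hX
end

section
/- Under the stated hypotheses (Mostow tangent decomposition of A at Z = W·P₁·P₂), assume moreover that ‖Y₂‖ ≤ β(Z)·cond(Z)·(1 + cond(Z)⁴)·‖A‖. Then ‖X‖ ≤ ‖P₁^{-1}‖·‖P₂^{-1}‖·(1 + ‖P₁‖·β(Z)·cond(Z)·(1 + cond(Z)⁴))·‖A‖. -/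
open Matrix MeasureTheory Real
open scoped Matrix.Norms.L2Operator ComplexOrder

-- ρ₂(Z) = (Z*Z # conj(Z*Z))^{1/2}
noncomputable def rho2 {n : ℕ} (Z : Matrix (Fin n) (Fin n) ℂ) : Matrix (Fin n) (Fin n) ℂ :=
  psqrt (gm (Zᴴ * Z) (mconj (Zᴴ * Z)))

-- C_Z = (Z*Z)⁻¹ (Z*Z # conj(Z*Z))
noncomputable def CZ {n : ℕ} (Z : Matrix (Fin n) (Fin n) ℂ) : Matrix (Fin n) (Fin n) ℂ :=
  (Zᴴ * Z)⁻¹ * gm (Zᴴ * Z) (mconj (Zᴴ * Z))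

-- β(Z) = ∫₀^∞ ‖exp(-t C_Z)‖² dt
noncomputable def beta {n : ℕ} (Z : Matrix (Fin n) (Fin n) ℂ) : ℝ :=
  ∫ t in Set.Ioi (0 : ℝ), ‖NormedSpace.exp ((-t) • CZ Z)‖ ^ 2

-- cond(Z) = ‖Z‖ ‖Z⁻¹‖
noncomputable def condNum {n : ℕ} (Z : Matrix (Fin n) (Fin n) ℂ) : ℝ := ‖Z‖ * ‖Z⁻¹‖

theorem aux_inner {n : ℕ} (H : Matrix (Fin n) (Fin n) ℂ) (hH : H.IsHermitian)
    (x y : EuclideanSpace ℂ (Fin n)) :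
    inner ℂ x (toEuclideanCLM (n := Fin n) (𝕜 := ℂ) H y)
      = inner ℂ (toEuclideanCLM (n := Fin n) (𝕜 := ℂ) H x) y := by
  have h1 : star (toEuclideanCLM (n := Fin n) (𝕜 := ℂ) H) = toEuclideanCLM (n := Fin n) (𝕜 := ℂ) H := by
    rw [← map_star, star_eq_conjTranspose, hH.eq]
  rw [ContinuousLinearMap.star_eq_adjoint] at h1
  conv_rhs => rw [← h1]
  rw [ContinuousLinearMap.adjoint_inner_left]

theorem aux_key {n : ℕ} (H Q P : Matrix (Fin n) (Fin n) ℂ) (hH : H.IsHermitian)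
    (hQ : Q.PosDef) (hQ2 : Q * Q = P) :
    ‖H‖ ≤ ‖P⁻¹‖ * (‖H * P + P * H‖ / 2) := by
  have hn1 : ‖H‖ = ‖(diagonal (RCLike.ofReal ∘ hH.eigenvalues) : Matrix (Fin n) (Fin n) ℂ)‖ := by
    conv_lhs => rw [hH.spectral_theorem]
    rw [Unitary.conjStarAlgAut_apply, ← Unitary.coe_star, CStarRing.norm_mul_coe_unitary,
      CStarRing.norm_coe_unitary_mul]
  rw [hn1, l2_opNorm_diagonal]
  refine (pi_norm_le_iff_of_nonneg (by positivity)).mpr fun i ↦ ?_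
  set T := toEuclideanCLM (n := Fin n) (𝕜 := ℂ) with hT
  set v := hH.eigenvectorBasis i with hv
  set l := hH.eigenvalues i with hl
  have hv1 : ‖v‖ = 1 := hH.eigenvectorBasis.orthonormal.1 i
  have hTv : T H v = (l : ℂ) • v := by
    apply (WithLp.ofLp_injective 2)
    rw [ofLp_toEuclideanCLM, hH.mulVec_eigenvectorBasis]
    ext j
    simp [hv, hl]
  have hTP : T P v = T Q (T Q v) := by rw [← hQ2, map_mul]; rfl
  have hq : inner ℂ v (T P v) = ((‖T Q v‖ ^ 2 : ℝ) : ℂ) := by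
    rw [hTP, aux_inner Q hQ.1, inner_self_eq_norm_sq_to_K]; push_cast; rfl
  have hK : inner ℂ v (T (H * P + P * H) v) = ((2 * l * ‖T Q v‖ ^ 2 : ℝ) : ℂ) := by
    have : T (H * P + P * H) v = T H (T P v) + T P (T H v) := by
      rw [map_add, map_mul, map_mul]; rfl
    rw [this, inner_add_right, aux_inner H hH, hTv, map_smul, inner_smul_left, inner_smul_right,
      hq]
    push_cast
    simp
    ring
  have hKn : |2 * l * ‖T Q v‖ ^ 2| ≤ ‖H * P + P * H‖ := by
    have h1 := norm_inner_le_norm (𝕜 := ℂ) v (T (H * P + P * H) v)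
    have h2 := (T (H * P + P * H)).le_opNorm v
    rw [hK, Complex.norm_real, Real.norm_eq_abs] at h1
    rw [l2_opNorm_toEuclideanCLM] at h2
    rw [hv1] at h1 h2
    linarith
  have hdet : IsUnit Q.det := (Matrix.isUnit_iff_isUnit_det Q).mp hQ.isUnit
  have hPinv : ‖P⁻¹‖ = ‖Q⁻¹‖ ^ 2 := by
    rw [← hQ2, Matrix.mul_inv_rev, sq, ← l2_opNorm_conjTranspose_mul_self, hQ.1.inv.eq]
  have hlow : 1 ≤ ‖P⁻¹‖ * ‖T Q v‖ ^ 2 := by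
    have h1 : v = T Q⁻¹ (T Q v) := by
      have : T Q⁻¹ (T Q v) = T (Q⁻¹ * Q) v := by rw [map_mul]; rfl
      rw [this, Matrix.nonsing_inv_mul _ hdet, map_one]; rfl
    have h2 := (T Q⁻¹).le_opNorm (T Q v)
    rw [← h1, hv1, l2_opNorm_toEuclideanCLM] at h2
    rw [hPinv, ← mul_pow]
    exact one_le_pow₀ h2
  have : ‖(RCLike.ofReal ∘ hH.eigenvalues : Fin n → ℂ) i‖ = |l| := by
    simp [hl]
  rw [this]
  rw [abs_mul, abs_mul, abs_of_nonneg (sq_nonneg ‖T Q v‖), abs_two] at hKn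
  have hp := norm_nonneg (P⁻¹)
  nlinarith [mul_le_mul_of_nonneg_left hKn hp, mul_le_mul_of_nonneg_left hlow (abs_nonneg l)]

/-- bound on the skew-Hermitian component of the Mostow tangent decomposition. -/
theorem stmt13 {n : ℕ} (hn : 0 < n)
    (W P₁ Q P₂ X Y₁ Y₂ A : Matrix (Fin n) (Fin n) ℂ)
    (hW : W ∈ Matrix.unitaryGroup (Fin n) ℂ)
    (hP₁ : P₁.PosDef) (hcirc : mconj P₁ * P₁ = 1)
    (hQ : Q.PosDef) (hQ2 : Q * Q = P₁)
    (hP₂ : P₂.PosDef) (hP₂r : ∀ i j, (P₂ i j).im = 0)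
    (hX : Xᴴ = -X)
    (hY₁r : ∀ i j, (Y₁ i j).im = 0) (hY₁ : Y₁ᵀ = -Y₁)
    (hY₂r : ∀ i j, (Y₂ i j).im = 0) (hY₂ : Y₂ᵀ = Y₂)
    (hA : A = W * X * P₁ * P₂ + W * Q * (Complex.I • Y₁) * Q * P₂ + W * P₁ * Y₂)
    (Z : Matrix (Fin n) (Fin n) ℂ) (hZ : Z = W * P₁ * P₂)
    (hY₂bd : ‖Y₂‖ ≤ beta Z * condNum Z * (1 + condNum Z ^ 4) * ‖A‖) :
    ‖X‖ ≤ ‖P₁⁻¹‖ * ‖P₂⁻¹‖ *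
      (1 + ‖P₁‖ * beta Z * condNum Z * (1 + condNum Z ^ 4)) * ‖A‖ := by
  have dP₂ : IsUnit P₂.det := (Matrix.isUnit_iff_isUnit_det P₂).mp hP₂.isUnit
  have hWW : Wᴴ * W = 1 := by
    rw [← star_eq_conjTranspose]; exact (Matrix.mem_unitaryGroup_iff').mp hW
  set B := Wᴴ * A * P₂⁻¹ - P₁ * Y₂ * P₂⁻¹ with hB
  have hBe : B = X * P₁ + Q * (Complex.I • Y₁) * Q := by
    have e : Wᴴ * A = X * P₁ * P₂ + Q * (Complex.I • Y₁) * Q * P₂ + P₁ * Y₂ := by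
      rw [hA]
      simp only [mul_add, ← mul_assoc, hWW, one_mul]
    rw [hB, e, add_mul, add_mul, Matrix.mul_nonsing_inv_cancel_right _ _ dP₂,
      Matrix.mul_nonsing_inv_cancel_right _ _ dP₂, add_sub_cancel_right]
  have hY₁H : Y₁ᴴ = -Y₁ := by
    rw [← hY₁]
    ext i j
    simp only [conjTranspose_apply, transpose_apply]
    exact Complex.conj_eq_iff_im.mpr (hY₁r j i)
  have hBs : B - Bᴴ = X * P₁ + P₁ * X := by
    rw [hBe]
    simp only [conjTranspose_add, conjTranspose_mul, conjTranspose_smul, hX, hP₁.1.eq, hQ.1.eq,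
      hY₁H]
    simp [mul_assoc]
  have hHerm : (Complex.I • X).IsHermitian := by
    rw [Matrix.IsHermitian, conjTranspose_smul, hX]; simp
  have key := aux_key (Complex.I • X) Q P₁ hHerm hQ hQ2
  have e2 : Complex.I • X * P₁ + P₁ * (Complex.I • X) = Complex.I • (B - Bᴴ) := by
    rw [hBs]; simp
  rw [e2, norm_smul, norm_smul, Complex.norm_I, one_mul, one_mul] at key
  have hBB : ‖B - Bᴴ‖ ≤ 2 * ‖B‖ := by
    have := norm_sub_le B Bᴴ
    rw [l2_opNorm_conjTranspose] at this
    linarith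
  have hWA : ‖Wᴴ * A‖ = ‖A‖ :=
    CStarRing.norm_mem_unitary_mul A (Unitary.star_mem hW)
  have hBn : ‖B‖ ≤ (‖A‖ + ‖P₁‖ * ‖Y₂‖) * ‖P₂⁻¹‖ := by
    have h1 := norm_sub_le (Wᴴ * A * P₂⁻¹) (P₁ * Y₂ * P₂⁻¹)
    have h2 := l2_opNorm_mul (Wᴴ * A) P₂⁻¹
    have h3 := l2_opNorm_mul (P₁ * Y₂) P₂⁻¹
    have h4 := mul_le_mul_of_nonneg_right (l2_opNorm_mul P₁ Y₂) (norm_nonneg P₂⁻¹)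
    rw [hWA] at h2
    linarith
  calc ‖X‖ ≤ ‖P₁⁻¹‖ * (‖B - Bᴴ‖ / 2) := key
    _ ≤ ‖P₁⁻¹‖ * ((‖A‖ + ‖P₁‖ * ‖Y₂‖) * ‖P₂⁻¹‖) := by
      gcongr
      linarith
    _ ≤ ‖P₁⁻¹‖ * ((‖A‖ + ‖P₁‖ * (beta Z * condNum Z * (1 + condNum Z ^ 4) * ‖A‖)) * ‖P₂⁻¹‖) := by
      gcongr
    _ = _ := by ring
end

section
/- Under the stated hypotheses (W₂ symmetric unitary, V symmetric unitary with V² = W₂, W₁ real orthogonal, S skew-Hermitian, X real skew-symmetric, Y = iH with H real symmetric, and W₁W₂S = W₁(X·W₂ + V·Y·V)), the following two matrix identities hold: W₂·Y + Y·W₂ = V³·S·V^{-1} + V^{-1}·Sᵗ·V³, and X·W₂ + W₂·X = W₂·S − Sᵗ·W₂. -/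
open Matrix MeasureTheory Real
open scoped Matrix.Norms.L2Operator ComplexOrder

/-- the two matrix identities obtained from the tangent decomposition of the
second/third polar decomposition of a unitary matrix (with `Y = iH`):
`W₂ Y + Y W₂ = V³ S V⁻¹ + V⁻¹ Sᵗ V³` and `X W₂ + W₂ X = W₂ S − Sᵗ W₂`. -/
theorem stmt16 {n : ℕ} (hn : 0 < n)
    (W₂ V W₁ S X H : Matrix (Fin n) (Fin n) ℂ)
    (hW₂t : W₂ᵀ = W₂) (hW₂u : W₂ᴴ * W₂ = 1)
    (hVt : Vᵀ = V) (hVu : Vᴴ * V = 1) (hV2 : V * V = W₂)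
    (hW₁r : ∀ i j, (W₁ i j).im = 0) (hW₁o : W₁ᵀ * W₁ = 1)
    (hS : Sᴴ = -S)
    (hXr : ∀ i j, (X i j).im = 0) (hXt : Xᵀ = -X)
    (hHr : ∀ i j, (H i j).im = 0) (hHt : Hᵀ = H)
    (heq : W₁ * W₂ * S = W₁ * (X * W₂ + V * (Complex.I • H) * V))
    :
    W₂ * (Complex.I • H) + (Complex.I • H) * W₂ = V ^ 3 * S * V⁻¹ + V⁻¹ * Sᵀ * V ^ 3 ∧
    X * W₂ + W₂ * X = W₂ * S - Sᵀ * W₂ := by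
  have hVi : V⁻¹ * V = 1 := by
    rw [Matrix.inv_eq_left_inv hVu]; exact hVu
  have hVi' : V * V⁻¹ = 1 := mul_eq_one_comm.mp hVi
  generalize hY : Complex.I • H = Y at *
  have hYt : Yᵀ = Y := by rw [← hY, transpose_smul, hHt]
  have h1 : W₂ * S = X * W₂ + V * Y * V := by
    have h := congrArg (fun M => W₁ᵀ * M) heq
    simpa only [← Matrix.mul_assoc, hW₁o, Matrix.one_mul] using h
  have h2 : Sᵀ * W₂ = -(W₂ * X) + V * Y * V := by
    have h := congrArg Matrix.transpose h1
    simpa only [transpose_mul, transpose_add, hW₂t, hVt, hXt, hYt, Matrix.mul_neg,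
      Matrix.mul_assoc] using h
  refine ⟨?_, ?_⟩
  · have e1 : V ^ 3 * S * V⁻¹ = V * X * V + W₂ * Y := by
      calc V ^ 3 * S * V⁻¹ = V * (W₂ * S) * V⁻¹ := by rw [← hV2]; noncomm_ring
        _ = V * X * V * (V * V⁻¹) + V * V * Y * (V * V⁻¹) := by
          rw [h1, ← hV2]; noncomm_ring
        _ = _ := by rw [hVi', hV2, Matrix.mul_one, Matrix.mul_one]
    have e2 : V⁻¹ * Sᵀ * V ^ 3 = -(V * X * V) + Y * W₂ := by
      calc V⁻¹ * Sᵀ * V ^ 3 = V⁻¹ * (Sᵀ * W₂) * V := by rw [← hV2]; noncomm_ring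
        _ = -((V⁻¹ * V) * (V * X * V)) + (V⁻¹ * V) * (Y * (V * V)) := by
          rw [h2, ← hV2]; noncomm_ring
        _ = _ := by rw [hVi, hV2, Matrix.one_mul, Matrix.one_mul]
    rw [e1, e2]; abel
  · rw [h1, h2]; abel
end

section
/- Under the stated hypotheses (W₂ symmetric unitary, V symmetric unitary with V² = W₂, W₁ real orthogonal, S skew-Hermitian, X real skew-symmetric, Y = iH with H real symmetric, and W₁W₂S = W₁(X·W₂ + V·Y·V)), let (a_n)_{n∈ℤ} be a sequence of complex numbers with Σ_{n∈ℤ} |a_n| < ∞ such that for all eigenvalues λ, μ of W₂ one has 1 + λ·conj(μ) ≠ 0 and Σ_{n∈ℤ} (−1)ⁿ a_n (λ·conj(μ))ⁿ = 1/(1 + λ·conj(μ)). Then ‖X‖ ≤ 2·(Σ_{n∈ℤ} |a_n|)·‖S‖ and ‖Y‖ ≤ 2·(Σ_{n∈ℤ} |a_n|)·‖S‖. -/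
open Matrix MeasureTheory Real
open scoped Matrix.Norms.L2Operator ComplexOrder

lemma norm_map_star_le {n : ℕ} (B : Matrix (Fin n) (Fin n) ℂ) : ‖B.map star‖ ≤ ‖B‖ := by
  rw [← l2_opNorm_toEuclideanCLM (B.map star)]
  refine ContinuousLinearMap.opNorm_le_bound _ (norm_nonneg _) fun x => ?_
  have h := B.l2_opNorm_mulVec (WithLp.toLp 2 (star x.ofLp))
  have e1 : ‖(WithLp.toLp 2 (star x.ofLp) : EuclideanSpace ℂ (Fin n))‖ = ‖x‖ := by
    simp [EuclideanSpace.norm_eq]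
  have e2 : ‖(EuclideanSpace.equiv (Fin n) ℂ).symm (B *ᵥ (star x.ofLp))‖
      = ‖toEuclideanCLM (n := Fin n) (𝕜 := ℂ) (B.map star) x‖ := by
    rw [EuclideanSpace.norm_eq, EuclideanSpace.norm_eq]
    congr 1
    refine Finset.sum_congr rfl fun i _ => ?_
    congr 1
    rw [← norm_star]
    simp [ofLp_toEuclideanCLM, mulVec, dotProduct]
  rw [e1] at h
  rw [← e2]
  exact h

lemma norm_transpose_le' {n : ℕ} (B : Matrix (Fin n) (Fin n) ℂ) : ‖Bᵀ‖ ≤ ‖B‖ := by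
  have h := norm_map_star_le Bᴴ
  rw [l2_opNorm_conjTranspose] at h
  have e : Bᴴ.map star = Bᵀ := by ext i j; simp
  rwa [e] at h

lemma eig_span {n : ℕ} (W : Matrix (Fin n) (Fin n) ℂ) (h1 : Wᴴ * W = 1) (h2 : W * Wᴴ = 1)
    (P : Submodule ℂ (Fin n → ℂ))
    (hP : ∀ (l : ℂ) (v : Fin n → ℂ), W *ᵥ v = l • v → v ∈ P) : ∀ v, v ∈ P := by
  have hA : (toEuclideanLin (W + Wᴴ)).IsSymmetric := by
    rw [← isHermitian_iff_isSymmetric]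
    simp [IsHermitian, add_comm]
  have hB : (toEuclideanLin (Complex.I • (W - Wᴴ))).IsSymmetric := by
    rw [← isHermitian_iff_isSymmetric]
    simp [IsHermitian, ← smul_neg]
  have hAB : Commute (toEuclideanLin (W + Wᴴ)) (toEuclideanLin (Complex.I • (W - Wᴴ))) := by
    have hc : (W + Wᴴ) * (Complex.I • (W - Wᴴ)) = (Complex.I • (W - Wᴴ)) * (W + Wᴴ) := by
      simp only [mul_smul_comm, smul_mul_assoc, add_mul, mul_add, mul_sub, sub_mul, h1, h2,
        ← smul_add]
      congr 1
      abel
    refine LinearMap.ext fun x => ?_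
    have := congrArg (fun M => WithLp.toLp 2 (M *ᵥ x.ofLp)) hc
    simp only [← mulVec_mulVec] at this
    exact this
  have ht := hA.iSup_iSup_eigenspace_inf_eigenspace_eq_top_of_commute hB hAB
  let Q : Submodule ℂ (EuclideanSpace ℂ (Fin n)) :=
    P.comap (WithLp.linearEquiv 2 ℂ (Fin n → ℂ)).toLinearMap
  have hQ : Q = ⊤ := by
    rw [eq_top_iff, ← ht]
    refine iSup_le fun α => iSup_le fun γ => ?_
    rintro x ⟨hx1, hx2⟩
    rw [SetLike.mem_coe, Module.End.mem_eigenspace_iff] at hx1 hx2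
    have hx1 := congrArg WithLp.ofLp hx1
    have hx2 := congrArg WithLp.ofLp hx2
    simp only [toEuclideanLin_apply, WithLp.ofLp_smul, add_mulVec, smul_mulVec, sub_mulVec]
      at hx1 hx2
    refine hP ((α - Complex.I * γ) / 2) x.ofLp ?_
    funext i
    have a1 := congrFun hx1 i
    have a2 := congrFun hx2 i
    simp only [Pi.add_apply, Pi.smul_apply, Pi.sub_apply, smul_eq_mul] at a1 a2 ⊢
    linear_combination a1 / 2 - Complex.I / 2 * a2 + (1/2) * ((W *ᵥ x.ofLp) i - (Wᴴ *ᵥ x.ofLp) i) * Complex.I_sq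
  intro v
  have : WithLp.toLp 2 v ∈ Q := by rw [hQ]; trivial
  exact this

lemma zpow_eig {n : ℕ} (U : unitary (Matrix (Fin n) (Fin n) ℂ)) (l : ℂ) (hl : l ≠ 0)
    (v : Fin n → ℂ) (h : (U : Matrix (Fin n) (Fin n) ℂ) *ᵥ v = l • v) (m : ℤ) :
    ((U ^ m : unitary (Matrix (Fin n) (Fin n) ℂ)) : Matrix (Fin n) (Fin n) ℂ) *ᵥ v
      = l ^ m • v := by
  have hinv : ((U⁻¹ : unitary (Matrix (Fin n) (Fin n) ℂ)) : Matrix (Fin n) (Fin n) ℂ) *ᵥ v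
      = l⁻¹ • v := by
    have e : ((U⁻¹ : unitary (Matrix (Fin n) (Fin n) ℂ)) : Matrix (Fin n) (Fin n) ℂ) *ᵥ
        ((U : Matrix (Fin n) (Fin n) ℂ) *ᵥ v) = v := by
      rw [mulVec_mulVec, ← Submonoid.coe_mul, inv_mul_cancel]; simp
    rw [h, mulVec_smul] at e
    rw [← inv_smul_smul₀ hl (_ *ᵥ v), e]
  induction m using Int.induction_on with
  | zero => simp
  | succ k ih =>
    rw [_root_.zpow_add_one, Submonoid.coe_mul, ← mulVec_mulVec, h, mulVec_smul, ih, smul_smul,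
      zpow_add_one₀ hl, mul_comm]
  | pred k ih =>
    rw [_root_.zpow_sub_one, Submonoid.coe_mul, ← mulVec_mulVec, hinv, mulVec_smul, ih, smul_smul,
      zpow_sub_one₀ hl, mul_comm]

lemma key {n : ℕ} (U : unitary (Matrix (Fin n) (Fin n) ℂ)) (A Z : Matrix (Fin n) (Fin n) ℂ)
    (hZ : A + (U : Matrix (Fin n) (Fin n) ℂ) * A * (U : Matrix (Fin n) (Fin n) ℂ)ᴴ = Z)
    (a : ℤ → ℂ) (ha : Summable fun m : ℤ => ‖a m‖)
    (hsum : ∀ lam mu : ℂ, lam ∈ spectrum ℂ (U : Matrix (Fin n) (Fin n) ℂ) →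
      mu ∈ spectrum ℂ (U : Matrix (Fin n) (Fin n) ℂ) →
      1 + lam * (starRingEnd ℂ) mu ≠ 0 ∧
      ∑' m : ℤ, (-1 : ℂ) ^ m * a m * (lam * (starRingEnd ℂ) mu) ^ m
        = 1 / (1 + lam * (starRingEnd ℂ) mu)) :
    ‖A‖ ≤ (∑' m : ℤ, ‖a m‖) * ‖Z‖ := by
  set W : Matrix (Fin n) (Fin n) ℂ := (U : Matrix (Fin n) (Fin n) ℂ) with hW
  have h1 : Wᴴ * W = 1 := Unitary.coe_star_mul_self U
  have h2 : W * Wᴴ = 1 := Unitary.coe_mul_star_self U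
  let f : ℤ → Matrix (Fin n) (Fin n) ℂ := fun m =>
    ((-1 : ℂ) ^ m * a m) • (((U ^ m : unitary (Matrix (Fin n) (Fin n) ℂ)) :
      Matrix (Fin n) (Fin n) ℂ) * Z * ((U ^ (-m) : unitary (Matrix (Fin n) (Fin n) ℂ)) :
      Matrix (Fin n) (Fin n) ℂ))
  have hf : ∀ m, ‖f m‖ ≤ ‖a m‖ * ‖Z‖ := by
    intro m
    simp only [f]
    rw [norm_smul, CStarRing.norm_mul_coe_unitary, CStarRing.norm_coe_unitary_mul]
    simp
  have hg : HasSum (fun m => ‖a m‖ * ‖Z‖) ((∑' m : ℤ, ‖a m‖) * ‖Z‖) := ha.hasSum.mul_right _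
  have hfs : Summable f := Summable.of_norm_bounded hg.summable hf
  suffices hA : A = ∑' m, f m by
    rw [hA]
    exact tsum_of_norm_bounded hg hf
  -- eigenvalue facts
  have heig : ∀ (l : ℂ) (v : Fin n → ℂ), v ≠ 0 → W *ᵥ v = l • v →
      l ∈ spectrum ℂ W ∧ l ≠ 0 ∧ (starRingEnd ℂ) l = l⁻¹ := by
    intro l v hv h
    have hs : l ∈ spectrum ℂ W := by
      rw [← spectrum_toLin', ← Module.End.hasEigenvalue_iff_mem_spectrum]
      exact Module.End.hasEigenvalue_of_hasEigenvector
        (Module.End.hasEigenvector_iff.2 ⟨Module.End.mem_eigenspace_iff.2 (by simpa using h), hv⟩)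
    have hn : ‖l‖ = 1 := by
      have := spectrum.subset_circle_of_unitary (𝕜 := ℂ) U.2 hs
      simpa using this
    refine ⟨hs, ?_, ?_⟩
    · intro h0; simp [h0] at hn
    · rw [Complex.inv_def, Complex.normSq_eq_norm_sq, hn]; simp
  have hadj : ∀ (l : ℂ) (v : Fin n → ℂ), v ≠ 0 → W *ᵥ v = l • v → Wᴴ *ᵥ v = l⁻¹ • v := by
    intro l v hv h
    have := zpow_eig U l (heig l v hv h).2.1 v h (-1)
    rw [_root_.zpow_neg, zpow_one, _root_.zpow_neg_one, ← Unitary.star_eq_inv, Unitary.coe_star] at this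
    exact this
  have hrow : ∀ (l : ℂ) (w : Fin n → ℂ), w ≠ 0 → W *ᵥ w = l • w → ∀ (m : ℤ) (x : Fin n → ℂ),
      star w ⬝ᵥ (((U ^ m : unitary (Matrix (Fin n) (Fin n) ℂ)) :
      Matrix (Fin n) (Fin n) ℂ) *ᵥ x) = l ^ m * (star w ⬝ᵥ x) := by
    intro l w hw h m x
    obtain ⟨_, h0, hc⟩ := heig l w hw h
    have e := zpow_eig U l h0 w h (-m)
    rw [dotProduct_mulVec]
    have e' := congrArg star e
    rw [star_mulVec] at e'
    have e3 : (((U ^ (-m) : unitary (Matrix (Fin n) (Fin n) ℂ)) :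
      Matrix (Fin n) (Fin n) ℂ))ᴴ = ((U ^ m : unitary (Matrix (Fin n) (Fin n) ℂ)) :
      Matrix (Fin n) (Fin n) ℂ) := by
      rw [← star_eq_conjTranspose, ← Unitary.coe_star, Unitary.star_eq_inv, ← _root_.zpow_neg, neg_neg]
    rw [e3] at e'
    rw [e', star_smul, smul_dotProduct, smul_eq_mul]
    congr 1
    rw [← starRingEnd_apply, map_zpow₀, hc]
    simp
  have hpair : ∀ (l : ℂ) (w : Fin n → ℂ), W *ᵥ w = l • w → ∀ (mu : ℂ) (v : Fin n → ℂ),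
      W *ᵥ v = mu • v → star w ⬝ᵥ ((A - ∑' m, f m) *ᵥ v) = 0 := by
    intro l w hw mu v hv
    by_cases hw0 : w = 0
    · simp [hw0]
    by_cases hv0 : v = 0
    · simp [hv0]
    obtain ⟨ls, l0, lc⟩ := heig l w hw0 hw
    obtain ⟨ms, m0, mc⟩ := heig mu v hv0 hv
    obtain ⟨hne, hs⟩ := hsum l mu ls ms
    let φ : Matrix (Fin n) (Fin n) ℂ →ₗ[ℂ] ℂ :=
      { toFun := fun M => star w ⬝ᵥ (M *ᵥ v)
        map_add' := fun M N => by rw [add_mulVec, dotProduct_add]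
        map_smul' := fun c M => by rw [smul_mulVec, dotProduct_smul]; rfl }
    have hφ := (LinearMap.toContinuousLinearMap φ).map_tsum hfs
    have hφ' : φ (∑' m, f m) = ∑' m, φ (f m) := hφ
    have hZv : φ Z = (1 + l * (starRingEnd ℂ) mu) * φ A := by
      rw [← hZ, map_add]
      have : φ (W * A * Wᴴ) = l * (starRingEnd ℂ) mu * φ A := by
        change star w ⬝ᵥ ((W * A * Wᴴ) *ᵥ v) = l * (starRingEnd ℂ) mu * (star w ⬝ᵥ (A *ᵥ v))
        have hr := hrow l w hw0 hw 1 (A *ᵥ (Wᴴ *ᵥ v))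
        rw [zpow_one, zpow_one, ← hW] at hr
        rw [← mulVec_mulVec, ← mulVec_mulVec, hr, hadj mu v hv0 hv, mc, mulVec_smul,
          dotProduct_smul, smul_eq_mul, mul_assoc]
      rw [this]; ring
    have hfm : ∀ m, φ (f m) = (-1 : ℂ) ^ m * a m * (l * (starRingEnd ℂ) mu) ^ m * φ Z := by
      intro m
      simp only [f, map_smul, smul_eq_mul]
      change (-1 : ℂ) ^ m * a m * (star w ⬝ᵥ (_ *ᵥ v)) = _ * (star w ⬝ᵥ (Z *ᵥ v))
      rw [← mulVec_mulVec, ← mulVec_mulVec, hrow l w hw0 hw m, zpow_eig U mu m0 v hv (-m),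
        mulVec_smul, dotProduct_smul, smul_eq_mul, mc, mul_zpow, _root_.inv_zpow, _root_.zpow_neg]
      ring
    change φ (A - ∑' m, f m) = 0
    rw [map_sub, hφ']
    simp_rw [hfm]
    rw [tsum_mul_right, hs, hZv]
    field_simp
    ring
  have hker : ∀ v, (A - ∑' m, f m) *ᵥ v = 0 := by
    refine eig_span W h1 h2 (LinearMap.ker (Matrix.toLin' (A - ∑' m, f m))) ?_
    intro mu v hv
    rw [LinearMap.mem_ker, Matrix.toLin'_apply]
    set x := (A - ∑' m, f m) *ᵥ v with hx
    let P : Submodule ℂ (Fin n → ℂ) :=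
      { carrier := {w | star w ⬝ᵥ x = 0}
        zero_mem' := by simp
        add_mem' := by
          intro p q hp hq
          simp only [Set.mem_ofPred_eq] at *
          rw [star_add, add_dotProduct, hp, hq, add_zero]
        smul_mem' := by
          intro c p hp
          simp only [Set.mem_ofPred_eq] at *
          rw [star_smul, smul_dotProduct, hp, smul_zero] }
    have := eig_span W h1 h2 P (fun l w hw => hpair l w hw mu v hv) x
    exact dotProduct_star_self_eq_zero.1 this
  rw [← sub_eq_zero]
  exact Matrix.ext_of_mulVec_single fun i => by rw [hker, zero_mulVec]

/-- bounds `‖X‖, ‖Y‖ ≤ 2 (Σ_{n∈ℤ} |a_n|) ‖S‖` where `(a_n)` is an `ℓ¹`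
sequence with `Σ (−1)ⁿ a_n (λ conj(μ))ⁿ = 1/(1 + λ conj(μ))` for eigenvalues `λ, μ` of `W₂`. -/
theorem stmt17 {n : ℕ} (hn : 0 < n)
    (W₂ V W₁ S X H : Matrix (Fin n) (Fin n) ℂ)
    (hW₂t : W₂ᵀ = W₂) (hW₂u : W₂ᴴ * W₂ = 1)
    (hVt : Vᵀ = V) (hVu : Vᴴ * V = 1) (hV2 : V * V = W₂)
    (hW₁r : ∀ i j, (W₁ i j).im = 0) (hW₁o : W₁ᵀ * W₁ = 1)
    (hS : Sᴴ = -S)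
    (hXr : ∀ i j, (X i j).im = 0) (hXt : Xᵀ = -X)
    (hHr : ∀ i j, (H i j).im = 0) (hHt : Hᵀ = H)
    (heq : W₁ * W₂ * S = W₁ * (X * W₂ + V * (Complex.I • H) * V))
    (a : ℤ → ℂ) (ha : Summable fun m : ℤ => ‖a m‖)
    (hsum : ∀ lam mu : ℂ, lam ∈ spectrum ℂ W₂ → mu ∈ spectrum ℂ W₂ →
      1 + lam * (starRingEnd ℂ) mu ≠ 0 ∧
      ∑' m : ℤ, (-1 : ℂ) ^ m * a m * (lam * (starRingEnd ℂ) mu) ^ m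
        = 1 / (1 + lam * (starRingEnd ℂ) mu)) :
    ‖X‖ ≤ 2 * (∑' m : ℤ, ‖a m‖) * ‖S‖ ∧
    ‖Complex.I • H‖ ≤ 2 * (∑' m : ℤ, ‖a m‖) * ‖S‖ := by
  have hV' : V * Vᴴ = 1 := mul_eq_one_comm.1 hVu
  have hW' : W₂ * W₂ᴴ = 1 := mul_eq_one_comm.1 hW₂u
  have hWV : W₂ᴴ = Vᴴ * Vᴴ := by rw [← hV2, conjTranspose_mul]
  have hVHt : Vᴴᵀ = Vᴴ := by
    have : (Vᵀ)ᴴ = Vᴴ := by rw [hVt]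
    rw [← this]
    ext i j
    simp [← congrFun (congrFun hVt i) j]
  have e0 : W₂ * S = X * W₂ + V * (Complex.I • H) * V := by
    have := congrArg (fun M => W₁ᵀ * M) heq
    simpa [← Matrix.mul_assoc, hW₁o] using this
  set Y := Complex.I • H with hY
  have hYt : Yᵀ = Y := by rw [hY, transpose_smul, hHt]
  have cV : ∀ M : Matrix (Fin n) (Fin n) ℂ, V * (Vᴴ * M) = M := fun M => by
    rw [← Matrix.mul_assoc, hV', Matrix.one_mul]
  have cV' : ∀ M : Matrix (Fin n) (Fin n) ℂ, Vᴴ * (V * M) = M := fun M => by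
    rw [← Matrix.mul_assoc, hVu, Matrix.one_mul]
  have eT : V * S * Vᴴ = Vᴴ * X * V + Y := by
    have := congrArg (fun M => Vᴴ * M * Vᴴ) e0
    simpa only [← hV2, Matrix.mul_add, Matrix.add_mul, Matrix.mul_assoc, cV, cV', hV', hVu,
      Matrix.mul_one] using this
  obtain ⟨T, hT⟩ : ∃ T, T = V * S * Vᴴ := ⟨_, rfl⟩
  rw [← hT] at eT
  have eTt : Tᵀ = -(V * X * Vᴴ) + Y := by
    rw [eT]
    simp only [transpose_add, transpose_mul, hVt, hVHt, hXt, hYt, Matrix.mul_assoc, Matrix.neg_mul,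
      Matrix.mul_neg]
  have mV : V ∈ unitary (Matrix (Fin n) (Fin n) ℂ) := ⟨hVu, hV'⟩
  have mVs : Vᴴ ∈ unitary (Matrix (Fin n) (Fin n) ℂ) := Unitary.star_mem mV
  have mW : W₂ ∈ unitary (Matrix (Fin n) (Fin n) ℂ) := ⟨hW₂u, hW'⟩
  have mWs : W₂ᴴ ∈ unitary (Matrix (Fin n) (Fin n) ℂ) := Unitary.star_mem mW
  have nT : ‖T‖ = ‖S‖ := by
    rw [hT, CStarRing.norm_mul_mem_unitary _ mVs, CStarRing.norm_mem_unitary_mul _ mV]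
  have nTt : ‖Tᵀ‖ ≤ ‖S‖ := nT ▸ norm_transpose_le' T
  have hnn : 0 ≤ ∑' m : ℤ, ‖a m‖ := tsum_nonneg fun _ => norm_nonneg _
  constructor
  · have k := key ⟨W₂, mW⟩ X (V * (T - Tᵀ) * Vᴴ) (by
      rw [eTt, eT, hWV]
      simp only [← hV2, Matrix.mul_add, Matrix.add_mul, Matrix.mul_assoc, cV, cV', hV', hVu,
        Matrix.mul_one, Matrix.mul_sub, Matrix.sub_mul, Matrix.mul_neg, Matrix.neg_mul]
      abel) a ha hsum
    rw [CStarRing.norm_mul_mem_unitary _ mVs, CStarRing.norm_mem_unitary_mul _ mV] at k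
    have := norm_sub_le T Tᵀ
    nlinarith
  · have k := key ⟨W₂, mW⟩ Y (W₂ * T * W₂ᴴ + Tᵀ) (by
      rw [eTt, eT, hWV]
      simp only [← hV2, Matrix.mul_add, Matrix.add_mul, Matrix.mul_assoc, cV, cV', hV', hVu,
        Matrix.mul_one, Matrix.mul_sub, Matrix.sub_mul, Matrix.mul_neg, Matrix.neg_mul]
      abel) a ha hsum
    have := norm_add_le (W₂ * T * W₂ᴴ) Tᵀ
    rw [CStarRing.norm_mul_mem_unitary _ mWs, CStarRing.norm_mem_unitary_mul _ mW] at this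
    nlinarith
end
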